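/- For every d ≥ 0, the graded piece R_n^d is spanned over Q by the standard monomials of degree d; that is, every element of R_n^d is a Q-linear combination of products ∏_{i ∈ A} a_i · ∏_{{j,k} ∈ M} b_{j,k}, where A and B are disjoint subsets of {1,…,n}, M is a perfect matching of B, and |A| + |B|/2 = d. -/

import Mathlib

open MvPolynomial

namespace TautCt

/-- The polynomial ring ℚ[a_i, b_{jk}] with variables `a i` for `i : Fin n` and
`b s` for `s` an off-diagonal unordered pair of elements of `Fin n`. -/
abbrev Pn (n : ℕ) : Type := MvPolynomial (Fin n ⊕ {s : Sym2 (Fin n) // ¬ s.IsDiag}) ℚ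

/-- The generator `a_i`. -/
noncomputable def aP (n : ℕ) (i : Fin n) : Pn n := X (Sum.inl i)

/-- The generator `b_s` for an unordered pair `s` (junk value `0` on the diagonal). -/
noncomputable def bS (n : ℕ) (s : Sym2 (Fin n)) : Pn n :=
  if h : s.IsDiag then 0 else X (Sum.inr ⟨s, h⟩)

/-- The generator `b_{i,j} = b_{j,i}`. -/
noncomputable def bP (n : ℕ) (i j : Fin n) : Pn n := bS n s(i, j)

/-- The defining relations of the tautological ring `R_n`. -/
def relSet (n : ℕ) : Set (Pn n) :=
  { x | (∃ i, x = aP n i ^ 2) ∨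
        (∃ i j, i ≠ j ∧ x = aP n i * bP n i j) ∨
        (∃ i j, i ≠ j ∧ x = bP n i j ^ 2 + 2 * (aP n i * aP n j)) ∨
        (∃ i j k, i ≠ j ∧ i ≠ k ∧ j ≠ k ∧
          x = bP n i j * bP n i k - aP n i * bP n j k) ∨
        (∃ i j k l, i ≠ j ∧ i ≠ k ∧ i ≠ l ∧ j ≠ k ∧ j ≠ l ∧ k ≠ l ∧
          x = bP n i j * bP n k l + bP n i k * bP n j l + bP n i l * bP n j k) }

noncomputable def relIdeal (n : ℕ) : Ideal (Pn n) := Ideal.span (relSet n)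

/-- The tautological ring `R_n = R^*(C^n)`. -/
abbrev Rn (n : ℕ) : Type := Pn n ⧸ relIdeal n

noncomputable def mkR (n : ℕ) : Pn n →ₐ[ℚ] Rn n := Ideal.Quotient.mkₐ ℚ (relIdeal n)

/-- The degree-`d` graded piece `R_n^d`: the image of the homogeneous degree-`d`
polynomials under the quotient map. -/
noncomputable def Rgrade (n d : ℕ) : Submodule ℚ (Rn n) :=
  (homogeneousSubmodule (Fin n ⊕ {s : Sym2 (Fin n) // ¬ s.IsDiag}) ℚ d).map
    (mkR n).toLinearMap

/-- `M` is a perfect matching of the subset `B ⊆ {1,…,n}`. -/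
def IsMatching (n : ℕ) (B : Finset (Fin n)) (M : Finset (Sym2 (Fin n))) : Prop :=
  (∀ s ∈ M, ¬ s.IsDiag) ∧
  (∀ s ∈ M, ∀ t ∈ M, s ≠ t → ∀ a : Fin n, a ∈ s → a ∉ t) ∧
  (∀ a : Fin n, a ∈ B ↔ ∃ s ∈ M, a ∈ s)

/-- The standard monomial `∏_{i ∈ A} a_i · ∏_{{j,k} ∈ M} b_{j,k}`. -/
noncomputable def stdMon (n : ℕ) (A : Finset (Fin n)) (M : Finset (Sym2 (Fin n))) : Pn n :=
  (∏ i ∈ A, aP n i) * ∏ s ∈ M, bS n s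


/-- `A` and `M` are the factors of a standard monomial: `M` consists of disjoint off-diagonal
pairs, none of which meets `A`. -/
def IsStandard (n : ℕ) (A : Finset (Fin n)) (M : Finset (Sym2 (Fin n))) : Prop :=
  (∀ s ∈ M, ¬ s.IsDiag) ∧
  (∀ s ∈ M, ∀ t ∈ M, s ≠ t → ∀ a : Fin n, a ∈ s → a ∉ t) ∧
  (∀ a ∈ A, ∀ s ∈ M, a ∉ s)

/-- The span of the standard monomials of degree `d`. -/
noncomputable def stdSpan (n d : ℕ) : Submodule ℚ (Rn n) :=
  Submodule.span ℚ { x | ∃ A M, IsStandard n A M ∧ A.card + M.card = d ∧ x = mkR n (stdMon n A M) }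

theorem IsMatching.card_eq {n : ℕ} {B : Finset (Fin n)} {M : Finset (Sym2 (Fin n))}
    (h : IsMatching n B M) : B.card = 2 * M.card := by
  obtain ⟨h1, h2, h3⟩ := h
  have hB : B = M.biUnion Sym2.toFinset := by
    ext a
    simp [h3]
  rw [hB, Finset.card_biUnion, Finset.sum_congr rfl
    (fun s hs => Sym2.card_toFinset_of_not_isDiag s (h1 s hs)), Finset.sum_const, smul_eq_mul,
    mul_comm]
  intro s hs t ht hst
  rw [Function.onFun, Finset.disjoint_left]
  intro a
  simpa using h2 s hs t ht hst a

theorem span_eq_stdSpan (n d : ℕ) :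
    Submodule.span ℚ
      { x : Rn n | ∃ (A B : Finset (Fin n)) (M : Finset (Sym2 (Fin n))),
          Disjoint A B ∧ IsMatching n B M ∧ A.card + B.card / 2 = d ∧
          x = mkR n (stdMon n A M) } = stdSpan n d := by
  unfold stdSpan
  congr 1
  ext x
  constructor
  · rintro ⟨A, B, M, hAB, hM, hd, rfl⟩
    refine ⟨A, M, ⟨hM.1, hM.2.1, fun a ha s hs has => ?_⟩, ?_, rfl⟩
    · exact Finset.disjoint_left.1 hAB ha ((hM.2.2 a).2 ⟨s, hs, has⟩)
    · have := hM.card_eq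
      omega
  · rintro ⟨A, M, hM, hd, rfl⟩
    have hB : IsMatching n (M.biUnion Sym2.toFinset) M := ⟨hM.1, hM.2.1, by simp⟩
    refine ⟨A, M.biUnion Sym2.toFinset, M, ?_, hB, ?_, rfl⟩
    · rw [Finset.disjoint_left]
      simpa using hM.2.2
    · have := hB.card_eq
      omega

theorem isHomogeneous_stdMon {n : ℕ} {A : Finset (Fin n)} {M : Finset (Sym2 (Fin n))}
    (h : ∀ s ∈ M, ¬ s.IsDiag) : (stdMon n A M).IsHomogeneous (A.card + M.card) := by
  refine IsHomogeneous.mul ?_ ?_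
  · simpa using IsHomogeneous.prod A (aP n) (fun _ => 1) fun i _ => isHomogeneous_X ℚ _
  · have := IsHomogeneous.prod M (bS n) (fun _ => 1) fun s hs => by
      rw [bS, dif_neg (h s hs)]
      exact isHomogeneous_X ℚ _
    simpa using this

theorem stdSpan_le_Rgrade (n d : ℕ) : stdSpan n d ≤ Rgrade n d := by
  refine Submodule.span_le.2 ?_
  rintro _ ⟨A, M, h, rfl, rfl⟩
  exact Submodule.mem_map_of_mem (isHomogeneous_stdMon h.1)

section Relations

variable {n : ℕ}

theorem mkR_eq_zero {x : Pn n} (h : x ∈ relSet n) : mkR n x = 0 :=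
  Ideal.Quotient.eq_zero_iff_mem.2 (Ideal.subset_span h)

theorem mkR_aP_mul_self (i : Fin n) : mkR n (aP n i) * mkR n (aP n i) = 0 := by
  rw [← map_mul, ← sq]
  exact mkR_eq_zero (Or.inl ⟨i, rfl⟩)

theorem mkR_aP_mul_bP {i j : Fin n} (h : i ≠ j) : mkR n (aP n i) * mkR n (bP n i j) = 0 := by
  rw [← map_mul]
  exact mkR_eq_zero (Or.inr (Or.inl ⟨i, j, h, rfl⟩))

theorem mkR_aP_mul_bS {i : Fin n} {s : Sym2 (Fin n)} (hs : ¬ s.IsDiag) (h : i ∈ s) :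
    mkR n (aP n i) * mkR n (bS n s) = 0 := by
  obtain ⟨j, rfl⟩ := Sym2.mem_iff_exists.1 h
  exact mkR_aP_mul_bP (by simpa using hs)

theorem mkR_bP_mul_self {i j : Fin n} (h : i ≠ j) :
    mkR n (bP n i j) * mkR n (bP n i j) = (-2 : ℚ) • (mkR n (aP n i) * mkR n (aP n j)) := by
  have := mkR_eq_zero (n := n) (Or.inr (Or.inr (Or.inl ⟨i, j, h, rfl⟩)))
  simp only [map_add, map_pow, map_mul, map_ofNat] at this
  rw [neg_smul, ofNat_smul_eq_nsmul, nsmul_eq_mul, ← sq]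
  push_cast
  exact eq_neg_of_add_eq_zero_left this

theorem mkR_bP_mul_bP {i j k : Fin n} (hij : i ≠ j) (hik : i ≠ k) (hjk : j ≠ k) :
    mkR n (bP n i j) * mkR n (bP n i k) = mkR n (aP n i) * mkR n (bP n j k) := by
  have := mkR_eq_zero (n := n) (Or.inr (Or.inr (Or.inr (Or.inl ⟨i, j, k, hij, hik, hjk, rfl⟩))))
  simp only [map_sub, map_mul] at this
  exact sub_eq_zero.1 this

theorem bP_comm (i j : Fin n) : bP n i j = bP n j i := by
  rw [bP, bP, Sym2.eq_swap]

theorem mkR_aP_mul_stdMon_of_mem {i : Fin n} {A : Finset (Fin n)} (M : Finset (Sym2 (Fin n)))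
    (hi : i ∈ A) : mkR n (aP n i) * mkR n (stdMon n A M) = 0 := by
  rw [stdMon, ← Finset.mul_prod_erase A _ hi, map_mul, map_mul, ← mul_assoc, ← mul_assoc,
    mkR_aP_mul_self, zero_mul, zero_mul]

theorem bS_mul_stdMon_erase (A : Finset (Fin n)) {M : Finset (Sym2 (Fin n))} {s : Sym2 (Fin n)}
    (hs : s ∈ M) : bS n s * stdMon n A (M.erase s) = stdMon n A M := by
  rw [stdMon, stdMon, ← Finset.mul_prod_erase M _ hs]
  ring

theorem IsStandard.erase {A : Finset (Fin n)} {M : Finset (Sym2 (Fin n))} (h : IsStandard n A M)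
    (s : Sym2 (Fin n)) : IsStandard n A (M.erase s) :=
  ⟨fun t ht => h.1 t (Finset.mem_of_mem_erase ht),
    fun t ht u hu => h.2.1 t (Finset.mem_of_mem_erase ht) u (Finset.mem_of_mem_erase hu),
    fun a ha t ht => h.2.2 a ha t (Finset.mem_of_mem_erase ht)⟩

theorem mkR_stdMon_mem {A : Finset (Fin n)} {M : Finset (Sym2 (Fin n))} (h : IsStandard n A M) :
    mkR n (stdMon n A M) ∈ stdSpan n (A.card + M.card) :=
  Submodule.subset_span ⟨A, M, h, rfl, rfl⟩

/-- To map `stdSpan n d` into `stdSpan n e` by a multiplication, it suffices to check standard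
monomials. -/
theorem mul_mem_stdSpan {d e : ℕ} {y : Rn n}
    (h : ∀ A M, IsStandard n A M → A.card + M.card = d → y * mkR n (stdMon n A M) ∈ stdSpan n e)
    {x : Rn n} (hx : x ∈ stdSpan n d) : y * x ∈ stdSpan n e := by
  have : stdSpan n d ≤ (stdSpan n e).comap (LinearMap.mulLeft ℚ y) := by
    refine Submodule.span_le.2 ?_
    rintro _ ⟨A, M, hM, hd, rfl⟩
    exact h A M hM hd
  exact this hx

theorem aP_mul_mem_stdSpan (i : Fin n) {d : ℕ} {x : Rn n} (hx : x ∈ stdSpan n d) :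
    mkR n (aP n i) * x ∈ stdSpan n (d + 1) := by
  refine mul_mem_stdSpan (fun A M h hd => ?_) hx
  by_cases hiA : i ∈ A
  · rw [mkR_aP_mul_stdMon_of_mem M hiA]
    exact zero_mem _
  by_cases hiM : ∃ s ∈ M, i ∈ s
  · obtain ⟨s, hs, his⟩ := hiM
    rw [← bS_mul_stdMon_erase A hs, map_mul, ← mul_assoc, mkR_aP_mul_bS (h.1 s hs) his, zero_mul]
    exact zero_mem _
  push Not at hiM
  have hst : IsStandard n (insert i A) M := by
    refine ⟨h.1, h.2.1, fun a ha => ?_⟩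
    rcases Finset.mem_insert.1 ha with rfl | ha
    exacts [hiM, h.2.2 a ha]
  have := mkR_stdMon_mem hst
  rw [stdMon, Finset.prod_insert hiA, mul_assoc, ← stdMon, map_mul,
    Finset.card_insert_of_notMem hiA] at this
  rwa [← hd, add_right_comm]

theorem bP_mul_mem_stdSpan {d : ℕ} :
    ∀ {i j : Fin n}, i ≠ j → ∀ {x : Rn n}, x ∈ stdSpan n d →
      mkR n (bP n i j) * x ∈ stdSpan n (d + 1) := by
  induction d with
  | zero =>
    intro i j hij x hx
    refine mul_mem_stdSpan (fun A M _ hd => ?_) hx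
    obtain ⟨hA, hM⟩ := Nat.add_eq_zero_iff.1 hd
    rw [Finset.card_eq_zero] at hA hM
    subst hA hM
    have hst : IsStandard n ∅ {s(i, j)} := by
      refine ⟨by simpa using hij, ?_, by simp⟩
      simp +contextual
    simpa [stdMon, bP] using mkR_stdMon_mem hst
  | succ d ih =>
    intro i j hij x hx
    refine mul_mem_stdSpan (fun A M h hd => ?_) hx
    have of_mem_A : ∀ i j : Fin n, i ≠ j → i ∈ A →
        mkR n (bP n i j) * mkR n (stdMon n A M) ∈ stdSpan n (d + 1 + 1) := by
      intro i j hij hi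
      rw [stdMon, ← Finset.mul_prod_erase A _ hi, map_mul, map_mul, ← mul_assoc, ← mul_assoc,
        mul_comm (mkR n (bP n i j)), mkR_aP_mul_bP hij, zero_mul, zero_mul]
      exact zero_mem _
    have of_mem_M : ∀ i j : Fin n, i ≠ j → (∃ s ∈ M, i ∈ s) →
        mkR n (bP n i j) * mkR n (stdMon n A M) ∈ stdSpan n (d + 1 + 1) := by
      rintro i j hij ⟨s, hs, his⟩
      obtain ⟨k, rfl⟩ := Sym2.mem_iff_exists.1 his
      have hik : i ≠ k := by simpa using h.1 _ hs
      have hm := mkR_stdMon_mem (h.erase s(i, k))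
      have hcard := Finset.card_erase_add_one hs
      rw [show A.card + (M.erase s(i, k)).card = d by omega] at hm
      rw [← bS_mul_stdMon_erase A hs, map_mul, ← mul_assoc, ← bP]
      by_cases hjk : j = k
      · subst hjk
        rw [mkR_bP_mul_self hij, smul_mul_assoc, mul_assoc]
        exact Submodule.smul_mem _ _ (aP_mul_mem_stdSpan i (aP_mul_mem_stdSpan j hm))
      · rw [mkR_bP_mul_bP hij hik hjk, mul_assoc]
        exact aP_mul_mem_stdSpan i (ih hjk hm)
    by_cases hiA : i ∈ A
    · exact of_mem_A i j hij hiA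
    by_cases hjA : j ∈ A
    · rw [bP_comm]
      exact of_mem_A j i hij.symm hjA
    by_cases hiM : ∃ s ∈ M, i ∈ s
    · exact of_mem_M i j hij hiM
    by_cases hjM : ∃ s ∈ M, j ∈ s
    · rw [bP_comm]
      exact of_mem_M j i hij.symm hjM
    push Not at hiM hjM
    have hnot : s(i, j) ∉ M := fun hs => hiM _ hs (Sym2.mem_mk_left i j)
    have hst : IsStandard n A (insert s(i, j) M) := by
      obtain ⟨h1, h2, h3⟩ := h
      refine ⟨?_, ?_, ?_⟩ <;> simp only [Finset.mem_insert, forall_eq_or_imp, Sym2.mem_iff]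
      · exact ⟨by simpa using hij, h1⟩
      · refine ⟨⟨by simp, ?_⟩, fun s hs => ⟨?_, h2 s hs⟩⟩
        · rintro t ht -
          exact ⟨hiM t ht, fun a ha => ha ▸ hjM t ht⟩
        · rintro - a ha (rfl | rfl)
          exacts [hiM s hs ha, hjM s hs ha]
      · refine fun a ha => ⟨?_, h3 a ha⟩
        rintro (rfl | rfl)
        exacts [hiA ha, hjA ha]
    have := mkR_stdMon_mem hst
    rw [← bS_mul_stdMon_erase A (Finset.mem_insert_self _ _), Finset.erase_insert hnot, map_mul,
      Finset.card_insert_of_notMem hnot] at this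
    rwa [← hd, add_assoc]

end Relations

theorem X_mul_mem_stdSpan {n d : ℕ} (v : Fin n ⊕ {s : Sym2 (Fin n) // ¬ s.IsDiag}) {x : Rn n}
    (hx : x ∈ stdSpan n d) : mkR n (X v) * x ∈ stdSpan n (d + 1) := by
  obtain i | ⟨s, hs⟩ := v
  · exact aP_mul_mem_stdSpan i hx
  · induction s with
    | _ i j =>
      have hij : i ≠ j := by simpa using hs
      have := bP_mul_mem_stdSpan hij hx
      rwa [bP, bS, dif_neg hs] at this

theorem Rgrade_le_stdSpan (n d : ℕ) : Rgrade n d ≤ stdSpan n d := by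
  rw [Rgrade, ← homogeneousSubmodule_one_pow, Submodule.map_pow]
  induction d with
  | zero =>
    have hst : IsStandard n ∅ ∅ := by simp [IsStandard]
    rw [pow_zero, Submodule.one_le]
    simpa [stdMon] using mkR_stdMon_mem hst
  | succ d ih =>
    rw [pow_succ', homogeneousSubmodule_one_eq_span_X, Submodule.map_span, Submodule.mul_le]
    rw [homogeneousSubmodule_one_eq_span_X, Submodule.map_span] at ih
    intro y hy x hx
    induction hy using Submodule.span_induction with
    | mem y hy =>
      obtain ⟨_, ⟨v, rfl⟩, rfl⟩ := hy
      exact X_mul_mem_stdSpan v (ih hx)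
    | zero => simp
    | add y z _ _ hy hz => rw [add_mul]; exact add_mem hy hz
    | smul c y _ hy => rw [smul_mul_assoc]; exact Submodule.smul_mem _ _ hy

/-- For every `d ≥ 0`, the graded piece `R_n^d` is spanned over ℚ by the
standard monomials `∏_{i ∈ A} a_i · ∏_{{j,k} ∈ M} b_{j,k}`, where `A`, `B` are disjoint
subsets of `{1,…,n}`, `M` is a perfect matching of `B`, and `|A| + |B|/2 = d`. -/
theorem graded_piece_spanned_by_standard_monomials (n : ℕ) (hn : 1 ≤ n) (d : ℕ) :
    Rgrade n d = Submodule.span ℚ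
      { x : Rn n | ∃ (A B : Finset (Fin n)) (M : Finset (Sym2 (Fin n))),
          Disjoint A B ∧ IsMatching n B M ∧ A.card + B.card / 2 = d ∧
          x = mkR n (stdMon n A M) } := by
  rw [span_eq_stdSpan]
  exact le_antisymm (Rgrade_le_stdSpan n d) (stdSpan_le_Rgrade n d)

end TautCt
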